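/- Let p be a prime, and identify binary cubic forms over 𝔽_p with quadruples (a,b,c,d) ∈ 𝔽_p⁴ via f(x,y)=ax³+bx²y+cxy²+dy³; call [x:y] ∈ ℙ¹(𝔽_p) a root of f if f(x,y)=0. Then: (i) the number of nonzero f having exactly 3 roots in ℙ¹(𝔽_p) is (1/6)(p−1)²p(p+1); (ii) the number of f with exactly 1 root and Disc(f) ≠ 0 is (1/2)(p−1)²p(p+1); (iii) the number of nonzero f with no root in ℙ¹(𝔽_p) is (1/3)(p−1)²p(p+1); (iv) the number of f with exactly 2 roots is (p−1)p(p+1); (v) the number of nonzero f with exactly 1 root and Disc(f) = 0 is (p−1)(p+1). -/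

import Mathlib

/-- The projective line over `ℤ/nℤ`: pairs generating the unit ideal, modulo scaling
by units. -/
def ProjLine (n : ℕ) : Type :=
  Quot fun v w : { v : ZMod n × ZMod n // Ideal.span {v.1, v.2} = ⊤ } =>
    ∃ u : (ZMod n)ˣ, w.1.1 = (u : ZMod n) * v.1.1 ∧ w.1.2 = (u : ZMod n) * v.1.2

/-- A representative of a point of the projective line. -/
noncomputable def ProjLine.rep {n : ℕ} (q : ProjLine n) : ZMod n × ZMod n :=
  (Classical.choose (Quot.exists_rep q)).1

/-- Evaluation of the binary cubic form `(a,b,c,d)` at `(x,y)`. -/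
def evalForm {A : Type*} [CommRing A] (f : A × A × A × A) (v : A × A) : A :=
  f.1 * v.1 ^ 3 + f.2.1 * v.1 ^ 2 * v.2 + f.2.2.1 * v.1 * v.2 ^ 2 + f.2.2.2 * v.2 ^ 3

/-- The number of roots of a binary cubic form in `ℙ¹(ℤ/nℤ)`.  (Whether a point is a
root does not depend on the chosen representative, since the form is homogeneous.) -/
noncomputable def numRoots (n : ℕ) (f : ZMod n × ZMod n × ZMod n × ZMod n) : ℕ :=
  Nat.card { q : ProjLine n // evalForm f q.rep = 0 }

/-- The discriminant `b²c² − 4ac³ − 4b³d − 27a²d² + 18abcd`. -/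
def discA {A : Type*} [CommRing A] (f : A × A × A × A) : A :=
  f.2.1 ^ 2 * f.2.2.1 ^ 2 - 4 * f.1 * f.2.2.1 ^ 3 - 4 * f.2.1 ^ 3 * f.2.2.2 -
    27 * f.1 ^ 2 * f.2.2.2 ^ 2 + 18 * f.1 * f.2.1 * f.2.2.1 * f.2.2.2

section Forms

variable {K : Type*} [Field K]

/-- The product of the linear forms `v.2 * x - v.1 * y` attached to three vectors, as a binary
cubic form. -/
def prodForm (u v w : K × K) : K × K × K × K :=
  (u.2 * v.2 * w.2, -(u.1 * v.2 * w.2 + u.2 * v.1 * w.2 + u.2 * v.2 * w.1),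
    u.1 * v.1 * w.2 + u.1 * v.2 * w.1 + u.2 * v.1 * w.1, -(u.1 * v.1 * w.1))

theorem evalForm_prodForm (u v w z : K × K) :
    evalForm (prodForm u v w) z =
      (z.1 * u.2 - u.1 * z.2) * (z.1 * v.2 - v.1 * z.2) * (z.1 * w.2 - w.1 * z.2) := by
  simp only [evalForm, prodForm]; ring

/-- Evaluation of binary cubic forms at a vector, as a linear map in the form. -/
def evalLin (v : K × K) : (K × K × K × K) →ₗ[K] K where
  toFun f := evalForm f v
  map_add' f g := by simp only [evalForm, Prod.fst_add, Prod.snd_add]; ring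
  map_smul' c f := by
    simp only [evalForm, Prod.smul_fst, Prod.smul_snd, smul_eq_mul, RingHom.id_apply]; ring

@[simp] theorem evalLin_apply (v : K × K) (f : K × K × K × K) : evalLin v f = evalForm f v := rfl

theorem evalForm_smul (c : K) (f : K × K × K × K) (v : K × K) :
    evalForm (c • f) v = c * evalForm f v := (evalLin v).map_smul c f

theorem evalForm_add (f g : K × K × K × K) (v : K × K) :
    evalForm (f + g) v = evalForm f v + evalForm g v := (evalLin v).map_add f g

theorem evalForm_zero (v : K × K) : evalForm (0 : K × K × K × K) v = 0 := (evalLin v).map_zero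

theorem evalForm_smul_right (f : K × K × K × K) (c : K) (v : K × K) :
    evalForm f (c • v) = c ^ 3 * evalForm f v := by
  simp only [evalForm, Prod.smul_fst, Prod.smul_snd, smul_eq_mul]; ring

/-- A binary cubic form with four pairwise non-proportional zeros vanishes. -/
theorem eq_zero_of_four_zeros (f : K × K × K × K) (v : Fin 4 → K × K)
    (hv : ∀ i j, i ≠ j → (v i).1 * (v j).2 ≠ (v j).1 * (v i).2)
    (hf : ∀ i, evalForm f (v i) = 0) : f = 0 := by
  have hdet : (Matrix.projVandermonde (fun i => (v i).1) (fun i => (v i).2)).det ≠ 0 := by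
    rw [Matrix.det_projVandermonde]
    refine Finset.prod_ne_zero_iff.2 fun i _ => Finset.prod_ne_zero_iff.2 fun j hj => ?_
    exact sub_ne_zero.2 (hv j i (Finset.mem_Ioi.1 hj).ne')
  have h := Matrix.eq_zero_of_mulVec_eq_zero hdet (v := ![f.2.2.2, f.2.2.1, f.2.1, f.1]) (by
    ext i
    have := hf i
    simp only [evalForm] at this
    simp [Matrix.mulVec, dotProduct, Fin.sum_univ_four, Matrix.projVandermonde_apply, Fin.rev]
    linear_combination this)
  have h0 := congrFun h 0
  have h1 := congrFun h 1
  have h2 := congrFun h 2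
  have h3 := congrFun h 3
  simp at h0 h1 h2 h3
  ext <;> simp [*]

/-- A binary cubic form with a zero `v` is the product of the linear form `v.2 * x - v.1 * y` and a
binary quadratic form `A x² + B x y + C y²`. -/
theorem exists_linear_mul_of_evalForm_eq_zero {f : K × K × K × K} {v : K × K} (hv : v ≠ 0)
    (hf : evalForm f v = 0) :
    ∃ A B C : K, f = (v.2 * A, v.2 * B - v.1 * A, v.2 * C - v.1 * B, -(v.1 * C)) := by
  obtain ⟨a, b, c, d⟩ := f
  obtain ⟨x, y⟩ := v
  simp only [evalForm] at hf
  by_cases hy : y = 0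
  · have hx : x ≠ 0 := by rintro rfl; exact hv (by simp [hy])
    subst hy
    have ha : a = 0 := by simpa [hx] using hf
    refine ⟨-b / x, -c / x, -d / x, ?_⟩
    ext <;> simp [ha] <;> field_simp
  · refine ⟨a / y, (b + x * (a / y)) / y, (c + x * ((b + x * (a / y)) / y)) / y, ?_⟩
    ext <;> simp <;> field_simp
    · ring
    · ring
    · linear_combination hf

/-- A binary quadratic form with a zero `v` is a product of two linear forms. -/
theorem exists_linear_mul_of_quadratic_eq_zero {A B C : K} {v : K × K} (hv : v ≠ 0)
    (hf : A * v.1 ^ 2 + B * v.1 * v.2 + C * v.2 ^ 2 = 0) :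
    ∃ w : K × K, A = v.2 * w.2 ∧ B = -(v.2 * w.1 + v.1 * w.2) ∧ C = v.1 * w.1 := by
  obtain ⟨x, y⟩ := v
  simp only at hf ⊢
  by_cases hy : y = 0
  · have hx : x ≠ 0 := by rintro rfl; exact hv (by simp [hy])
    subst hy
    have ha : A = 0 := by simpa [hx] using hf
    refine ⟨(C / x, -B / x), ?_, ?_, ?_⟩ <;> simp [ha] <;> field_simp
  · refine ⟨(-(B + x * (A / y)) / y, A / y), ?_, ?_, ?_⟩ <;> simp only <;> field_simp
    · ring
    · linear_combination hf

/-- A binary quadratic form of discriminant zero over a finite field has a nontrivial zero. -/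
theorem exists_quadratic_zero_of_disc_eq_zero [Finite K] {A B C : K} (h : B ^ 2 - 4 * A * C = 0) :
    ∃ v : K × K, v ≠ 0 ∧ A * v.1 ^ 2 + B * v.1 * v.2 + C * v.2 ^ 2 = 0 := by
  by_cases hA : A = 0
  · exact ⟨(1, 0), by simp, by simp [hA]⟩
  by_cases h2 : (2 : K) = 0
  · have hB : B = 0 := by
      have : B ^ 2 = 0 := by linear_combination h + 2 * A * C * h2
      simpa using this
    have : Fintype K := Fintype.ofFinite K
    have hchar : ringChar K = 2 :=
      CharP.ringChar_of_prime_eq_zero Nat.prime_two (by exact_mod_cast h2)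
    obtain ⟨s, hs⟩ := FiniteField.isSquare_of_char_two hchar (C / A)
    refine ⟨(s, 1), by simp, ?_⟩
    have : A * (s * s) = C := by rw [← hs]; field_simp
    simp only [hB]
    linear_combination this + C * h2
  · refine ⟨(-B, 2 * A), by simp [hA, h2], ?_⟩
    simp only
    linear_combination -A * h

theorem discA_smul_prodForm_self (c : K) (v : K × K) : discA (c • prodForm v v v) = 0 := by
  simp only [discA, prodForm, Prod.smul_fst, Prod.smul_snd, smul_eq_mul]; ring

/-- Over a finite field, a nonzero binary cubic form of discriminant zero all of whose zeros are
proportional to `v` is a multiple of the cube of a linear form. -/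
theorem exists_eq_smul_prodForm_self [Finite K] {f : K × K × K × K} {v : K × K} (hv : v ≠ 0)
    (hf : f ≠ 0) (hfv : evalForm f v = 0) (hdisc : discA f = 0)
    (huniq : ∀ w : K × K, w ≠ 0 → evalForm f w = 0 → ∃ c : K, w = c • v) :
    ∃ c : K, c ≠ 0 ∧ f = c • prodForm v v v := by
  obtain ⟨A, B, C, hABC⟩ := exists_linear_mul_of_evalForm_eq_zero hv hfv
  have heval (w : K × K) : evalForm f w =
      (w.1 * v.2 - v.1 * w.2) * (A * w.1 ^ 2 + B * w.1 * w.2 + C * w.2 ^ 2) := by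
    rw [hABC]; simp only [evalForm]; ring
  have hQ : A * v.1 ^ 2 + B * v.1 * v.2 + C * v.2 ^ 2 = 0 := by
    have : (B ^ 2 - 4 * A * C) * (A * v.1 ^ 2 + B * v.1 * v.2 + C * v.2 ^ 2) ^ 2 = 0 := by
      rw [← hdisc, hABC]; simp only [discA]; ring
    rcases mul_eq_zero.1 this with h | h
    · obtain ⟨w, hw0, hw⟩ := exists_quadratic_zero_of_disc_eq_zero h
      obtain ⟨c, rfl⟩ := huniq w hw0 (by rw [heval, hw, mul_zero])
      have hc : c ≠ 0 := by rintro rfl; simp at hw0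
      have : c ^ 2 * (A * v.1 ^ 2 + B * v.1 * v.2 + C * v.2 ^ 2) = 0 := by
        rw [← hw]; simp only [Prod.smul_fst, Prod.smul_snd, smul_eq_mul]; ring
      simpa [hc] using this
    · simpa using h
  obtain ⟨w, rfl, rfl, rfl⟩ := exists_linear_mul_of_quadratic_eq_zero hv hQ
  have hw0 : w ≠ 0 := by rintro rfl; exact hf (by simp [hABC])
  obtain ⟨c, rfl⟩ := huniq w hw0 (by rw [heval]; ring)
  refine ⟨c, by rintro rfl; simp at hw0, ?_⟩
  rw [hABC]
  ext <;> simp [prodForm] <;> ring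

end Forms

namespace ProjLine

variable {p : ℕ} [Fact p.Prime]

theorem span_pair_eq_top {v : ZMod p × ZMod p} (hv : v ≠ 0) : Ideal.span {v.1, v.2} = ⊤ := by
  by_cases h : v.1 = 0
  · have h2 : v.2 ≠ 0 := fun h2 => hv (Prod.ext h h2)
    exact Ideal.eq_top_of_isUnit_mem _ (Ideal.subset_span (by simp)) h2.isUnit
  · exact Ideal.eq_top_of_isUnit_mem _ (Ideal.subset_span (by simp)) (Ne.isUnit h)

theorem ne_zero_of_span_pair_eq_top {v : ZMod p × ZMod p} (hv : Ideal.span {v.1, v.2} = ⊤) :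
    v ≠ 0 := by
  rintro rfl
  simp at hv

/-- The point of the projective line spanned by a nonzero vector. -/
def mk (v : ZMod p × ZMod p) (hv : v ≠ 0) : ProjLine p := Quot.mk _ ⟨v, span_pair_eq_top hv⟩

theorem rep_ne_zero (q : ProjLine p) : q.rep ≠ 0 :=
  ne_zero_of_span_pair_eq_top (Classical.choose (Quot.exists_rep q)).2

theorem mk_rep (q : ProjLine p) : mk q.rep q.rep_ne_zero = q :=
  Classical.choose_spec (Quot.exists_rep q)

theorem exists_smul_eq_of_det_eq_zero {v w : ZMod p × ZMod p} (hv : v ≠ 0) (hw : w ≠ 0)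
    (h : v.1 * w.2 = w.1 * v.2) : ∃ u : (ZMod p)ˣ, w = (u : ZMod p) • v := by
  suffices ∃ c : ZMod p, w = c • v by
    obtain ⟨c, rfl⟩ := this
    exact ⟨Units.mk0 c (by rintro rfl; simp at hw), rfl⟩
  by_cases h1 : v.1 = 0
  · have h2 : v.2 ≠ 0 := fun h2 => hv (Prod.ext h1 h2)
    refine ⟨w.2 / v.2, Prod.ext ?_ ?_⟩ <;> simp <;> field_simp
    linear_combination -h
  · refine ⟨w.1 / v.1, Prod.ext ?_ ?_⟩ <;> simp <;> field_simp
    linear_combination h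

theorem mk_eq_mk_iff {v w : ZMod p × ZMod p} (hv : v ≠ 0) (hw : w ≠ 0) :
    mk v hv = mk w hw ↔ v.1 * w.2 = w.1 * v.2 := by
  constructor
  · intro h
    let g : ProjLine p → Prop := Quot.lift (fun z => v.1 * z.1.2 = z.1.1 * v.2) (by
      rintro a b ⟨u, h1, h2⟩
      simp only [h1, h2, eq_iff_iff]
      rw [mul_left_comm, mul_assoc, u.isUnit.mul_right_inj])
    have hg : g (mk v hv) := rfl
    rw [h] at hg
    exact hg
  · intro h
    obtain ⟨u, rfl⟩ := exists_smul_eq_of_det_eq_zero hv hw h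
    exact Quot.sound ⟨u, rfl, rfl⟩

theorem det_rep_ne_zero {q r : ProjLine p} (h : q ≠ r) :
    q.rep.1 * r.rep.2 - r.rep.1 * q.rep.2 ≠ 0 := by
  rw [sub_ne_zero, Ne, ← mk_eq_mk_iff q.rep_ne_zero r.rep_ne_zero, mk_rep, mk_rep]
  exact h

/-- The projective line is the affine line together with a point at infinity. -/
noncomputable def optionEquiv : Option (ZMod p) ≃ ProjLine p :=
  Equiv.ofBijective
    (fun o => o.elim (mk (1, 0) (by simp)) fun t => mk (t, 1) (by simp)) (by
      constructor
      · rintro (_ | s) (_ | t) h <;> simp [mk_eq_mk_iff] at h ⊢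
        exact h
      · intro q
        rw [← mk_rep q]
        by_cases h : q.rep.2 = 0
        · exact ⟨none, (mk_eq_mk_iff (by simp) q.rep_ne_zero).2 (by simp [h])⟩
        · exact ⟨some (q.rep.1 / q.rep.2),
            (mk_eq_mk_iff (by simp) q.rep_ne_zero).2 (by simp; field_simp)⟩)

noncomputable instance : Fintype (ProjLine p) := Fintype.ofEquiv _ optionEquiv

theorem card_eq : Fintype.card (ProjLine p) = p + 1 := by
  rw [← Fintype.card_congr (optionEquiv (p := p)), Fintype.card_option, ZMod.card]

end ProjLine

open Classical in
/-- The set of roots of a binary cubic form on the projective line. -/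
noncomputable def rootSet {p : ℕ} [Fact p.Prime] (f : ZMod p × ZMod p × ZMod p × ZMod p) :
    Finset (ProjLine p) :=
  {q | evalForm f q.rep = 0}

section Counting

variable {p : ℕ} [Fact p.Prime]

theorem mem_rootSet {f : ZMod p × ZMod p × ZMod p × ZMod p} {q : ProjLine p} :
    q ∈ rootSet f ↔ evalForm f q.rep = 0 := by simp [rootSet]

theorem numRoots_eq_card (f : ZMod p × ZMod p × ZMod p × ZMod p) :
    numRoots p f = (rootSet f).card := by
  simp only [numRoots, ← mem_rootSet, Nat.card_eq_fintype_card, Fintype.card_coe]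

theorem numRoots_zero : numRoots p 0 = p + 1 := by
  have : rootSet (0 : ZMod p × ZMod p × ZMod p × ZMod p) = Finset.univ := by
    ext q; simp [mem_rootSet, evalForm_zero]
  rw [numRoots_eq_card, this, Finset.card_univ, ProjLine.card_eq]

theorem numRoots_lt_four {f : ZMod p × ZMod p × ZMod p × ZMod p} (hf : f ≠ 0) :
    numRoots p f < 4 := by
  rw [numRoots_eq_card]
  by_contra! h
  obtain ⟨T, hT, hcard⟩ := Finset.exists_subset_card_eq h
  let e := T.equivFinOfCardEq hcard
  refine hf (eq_zero_of_four_zeros f (fun i => (e.symm i).1.rep) (fun i j hij => ?_) fun i => ?_)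
  · exact sub_ne_zero.1 <| ProjLine.det_rep_ne_zero fun h =>
      hij (e.symm.injective (Subtype.ext h))
  · exact mem_rootSet.1 (hT (e.symm i).2)

/-- Binary cubic forms take arbitrary values at up to three points. -/
theorem exists_evalForm_eq (T : Finset (ProjLine p)) (hT : T.card ≤ 3) (g : ProjLine p → ZMod p) :
    ∃ f, ∀ q ∈ T, evalForm f q.rep = g q := by
  classical
  have hp := (Fact.out : p.Prime).two_le
  obtain ⟨T', hTT', hT'⟩ := Finset.exists_superset_card_eq hT
    (by rw [ProjLine.card_eq]; omega)
  obtain ⟨u, v, w, huv, huw, hvw, rfl⟩ := Finset.card_eq_three.1 hT'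
  have key (a b c : ProjLine p) (hab : a ≠ b) (hac : a ≠ c) :
      ∃ f, evalForm f a.rep = g a ∧ evalForm f b.rep = 0 ∧ evalForm f c.rep = 0 := by
    have h : evalForm (prodForm b.rep b.rep c.rep) a.rep ≠ 0 := by
      rw [evalForm_prodForm]
      have := ProjLine.det_rep_ne_zero hab
      have := ProjLine.det_rep_ne_zero hac
      positivity
    refine ⟨(g a / evalForm (prodForm b.rep b.rep c.rep) a.rep) • prodForm b.rep b.rep c.rep,
      ?_, ?_, ?_⟩
    · rw [evalForm_smul, div_mul_cancel₀ _ h]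
    all_goals
      rw [evalForm_smul, mul_eq_zero]
      right
      rw [evalForm_prodForm]
      ring
  obtain ⟨f₁, h₁⟩ := key u v w huv huw
  obtain ⟨f₂, h₂⟩ := key v u w huv.symm hvw
  obtain ⟨f₃, h₃⟩ := key w u v huw.symm hvw.symm
  refine ⟨f₁ + f₂ + f₃, fun q hq => ?_⟩
  have hq' := hTT' hq
  simp only [Finset.mem_insert, Finset.mem_singleton] at hq'
  rcases hq' with rfl | rfl | rfl <;> simp [evalForm_add, h₁, h₂, h₃]

open Classical in
theorem card_filter_subset_rootSet (T : Finset (ProjLine p)) (hT : T.card ≤ 3) :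
    Finset.card {f : ZMod p × ZMod p × ZMod p × ZMod p | T ⊆ rootSet f} = p ^ (4 - T.card) := by
  let φ : (ZMod p × ZMod p × ZMod p × ZMod p) →ₗ[ZMod p] (T → ZMod p) :=
    LinearMap.pi fun q => evalLin q.1.rep
  have hφ : Function.Surjective φ := fun g => by
    obtain ⟨f, hf⟩ := exists_evalForm_eq T hT fun q => if h : q ∈ T then g ⟨q, h⟩ else 0
    refine ⟨f, funext fun q => ?_⟩
    simp [φ, hf q.1 q.2]
  have hrank := φ.finrank_range_add_finrank_ker
  rw [LinearMap.range_eq_top.2 hφ] at hrank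
  simp at hrank
  have hker : Module.finrank (ZMod p) φ.ker = 4 - T.card := by omega
  have hcard := Module.natCard_eq_pow_finrank (K := ZMod p) (V := φ.ker)
  rw [hker, Nat.card_zmod] at hcard
  rw [← hcard, ← Nat.subtype_card (p := fun f => f ∈ φ.ker)]
  intro f
  simp [φ, funext_iff, Finset.subset_iff, mem_rootSet]

theorem sum_choose_numRoots (k : ℕ) (hk : k ≤ 3) :
    ∑ f : ZMod p × ZMod p × ZMod p × ZMod p, (numRoots p f).choose k =
      (p + 1).choose k * p ^ (4 - k) := by
  classical
  calc _ = ∑ f : ZMod p × ZMod p × ZMod p × ZMod p,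
        Finset.card {T ∈ Finset.univ.powersetCard k | T ⊆ rootSet f} := by
        refine Finset.sum_congr rfl fun f _ => ?_
        rw [numRoots_eq_card, ← Finset.card_powersetCard]
        congr 1
        ext T
        simp [Finset.mem_powersetCard, and_comm]
    _ = ∑ T ∈ (Finset.univ : Finset (ProjLine p)).powersetCard k,
        Finset.card {f : ZMod p × ZMod p × ZMod p × ZMod p | T ⊆ rootSet f} :=
        Finset.sum_card_bipartiteAbove_eq_sum_card_bipartiteBelow fun f T => T ⊆ rootSet f
    _ = ∑ T ∈ (Finset.univ : Finset (ProjLine p)).powersetCard k, p ^ (4 - k) := by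
        refine Finset.sum_congr rfl fun T hT => ?_
        have := (Finset.mem_powersetCard.1 hT).2
        rw [card_filter_subset_rootSet T (by omega), this]
    _ = _ := by
        rw [Finset.sum_const, Finset.card_powersetCard, Finset.card_univ, ProjLine.card_eq,
          smul_eq_mul]

theorem choose_add_sum_choose_mul_card (k : ℕ) (hk : k ≤ 3) :
    (p + 1).choose k + ∑ j ∈ Finset.range 4, j.choose k *
      Nat.card {f : ZMod p × ZMod p × ZMod p × ZMod p // f ≠ 0 ∧ numRoots p f = j} =
      (p + 1).choose k * p ^ (4 - k) := by
  classical
  rw [← sum_choose_numRoots k hk, ← Finset.add_sum_erase _ _ (Finset.mem_univ 0), numRoots_zero,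
    ← Finset.sum_fiberwise_of_maps_to (t := Finset.range 4) (g := numRoots p)
      fun f hf => Finset.mem_range.2 (numRoots_lt_four (Finset.ne_of_mem_erase hf))]
  congr 1
  refine Finset.sum_congr rfl fun j _ => ?_
  rw [Finset.sum_congr rfl fun f hf => by rw [(Finset.mem_filter.1 hf).2], Finset.sum_const,
    smul_eq_mul, mul_comm, Nat.subtype_card]
  simp

theorem rootSet_smul_prodForm_self {c : ZMod p} (hc : c ≠ 0) (q : ProjLine p) :
    rootSet (c • prodForm q.rep q.rep q.rep) = {q} := by
  ext r
  rw [mem_rootSet, Finset.mem_singleton, evalForm_smul, evalForm_prodForm]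
  refine ⟨fun h => ?_, fun h => by rw [h]; ring⟩
  by_contra hr
  have := ProjLine.det_rep_ne_zero hr
  exact absurd h (by positivity)

/-- The nonzero forms with one root and discriminant zero are the multiples of cubes. -/
theorem card_one_root_disc_eq_zero :
    Nat.card {f : ZMod p × ZMod p × ZMod p × ZMod p //
      f ≠ 0 ∧ numRoots p f = 1 ∧ discA f = 0} = (p - 1) * (p + 1) := by
  have hne (c : (ZMod p)ˣ) (q : ProjLine p) :
      (c : ZMod p) • prodForm q.rep q.rep q.rep ≠ 0 ∧
      numRoots p ((c : ZMod p) • prodForm q.rep q.rep q.rep) = 1 := by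
    have h1 : numRoots p ((c : ZMod p) • prodForm q.rep q.rep q.rep) = 1 := by
      rw [numRoots_eq_card, rootSet_smul_prodForm_self c.ne_zero, Finset.card_singleton]
    refine ⟨fun h => ?_, h1⟩
    rw [h, numRoots_zero] at h1
    exact (Fact.out : p.Prime).ne_zero (by omega)
  let F : (ZMod p)ˣ × ProjLine p → {f : ZMod p × ZMod p × ZMod p × ZMod p //
      f ≠ 0 ∧ numRoots p f = 1 ∧ discA f = 0} := fun x =>
    ⟨(x.1 : ZMod p) • prodForm x.2.rep x.2.rep x.2.rep, (hne x.1 x.2).1, (hne x.1 x.2).2,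
      discA_smul_prodForm_self _ _⟩
  have hF : Function.Bijective F := by
    constructor
    · rintro ⟨c, q⟩ ⟨d, r⟩ h
      have h' := congrArg Subtype.val h
      simp only [F] at h'
      have hq := congrArg rootSet h'
      rw [rootSet_smul_prodForm_self c.ne_zero, rootSet_smul_prodForm_self d.ne_zero,
        Finset.singleton_inj] at hq
      subst hq
      have hcube : prodForm q.rep q.rep q.rep ≠ 0 := fun h0 => (hne c q).1 (by rw [h0, smul_zero])
      exact Prod.ext (Units.ext (smul_left_injective _ hcube h')) rfl
    · rintro ⟨f, hf, h1, hdisc⟩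
      rw [numRoots_eq_card, Finset.card_eq_one] at h1
      obtain ⟨q, hq⟩ := h1
      have hroot : evalForm f q.rep = 0 := mem_rootSet.1 (by simp [hq])
      obtain ⟨c, hc, rfl⟩ := exists_eq_smul_prodForm_self q.rep_ne_zero hf hroot hdisc (by
        intro w hw hfw
        obtain ⟨u, hu⟩ := ProjLine.exists_smul_eq_of_det_eq_zero (ProjLine.rep_ne_zero _) hw
          ((ProjLine.mk_eq_mk_iff _ _).1 (ProjLine.mk_rep (ProjLine.mk w hw)))
        have hmem : ProjLine.mk w hw ∈ rootSet f := by
          rw [hu, evalForm_smul_right] at hfw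
          exact mem_rootSet.2 (by simpa using hfw)
        rw [hq, Finset.mem_singleton] at hmem
        rw [hmem] at hu
        exact ⟨u, hu⟩)
      exact ⟨(Units.mk0 c hc, q), rfl⟩
  rw [← Nat.card_eq_of_bijective F hF, Nat.card_prod, Nat.card_eq_fintype_card,
    Nat.card_eq_fintype_card, ProjLine.card_eq, ZMod.card_units]

theorem card_one_root_disc_add :
    Nat.card {f : ZMod p × ZMod p × ZMod p × ZMod p // numRoots p f = 1 ∧ discA f ≠ 0} +
      Nat.card {f : ZMod p × ZMod p × ZMod p × ZMod p //
        f ≠ 0 ∧ numRoots p f = 1 ∧ discA f = 0} =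
      Nat.card {f : ZMod p × ZMod p × ZMod p × ZMod p // f ≠ 0 ∧ numRoots p f = 1} := by
  classical
  simp only [Nat.card_eq_fintype_card, Fintype.card_subtype]
  rw [← Finset.card_union_of_disjoint]
  · congr 1
    ext f
    have : discA f ≠ 0 → f ≠ 0 := by rintro h rfl; simp [discA] at h
    simp only [Finset.mem_union, Finset.mem_filter, Finset.mem_univ, true_and]
    tauto
  · rw [Finset.disjoint_left]
    intro f
    simp only [Finset.mem_filter, Finset.mem_univ, true_and]
    tauto

end Counting

theorem splitting_type_counts (p : ℕ) (hp : p.Prime) :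
    6 * Nat.card { f : ZMod p × ZMod p × ZMod p × ZMod p // f ≠ 0 ∧ numRoots p f = 3 } =
        (p - 1) ^ 2 * p * (p + 1) ∧
    2 * Nat.card { f : ZMod p × ZMod p × ZMod p × ZMod p //
        numRoots p f = 1 ∧ discA f ≠ 0 } = (p - 1) ^ 2 * p * (p + 1) ∧
    3 * Nat.card { f : ZMod p × ZMod p × ZMod p × ZMod p // f ≠ 0 ∧ numRoots p f = 0 } =
        (p - 1) ^ 2 * p * (p + 1) ∧
    Nat.card { f : ZMod p × ZMod p × ZMod p × ZMod p // numRoots p f = 2 } =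
        (p - 1) * p * (p + 1) ∧
    Nat.card { f : ZMod p × ZMod p × ZMod p × ZMod p //
        f ≠ 0 ∧ numRoots p f = 1 ∧ discA f = 0 } = (p - 1) * (p + 1) := by
  have : Fact p.Prime := ⟨hp⟩
  have h2 : Nat.card {f : ZMod p × ZMod p × ZMod p × ZMod p // numRoots p f = 2} =
      Nat.card {f : ZMod p × ZMod p × ZMod p × ZMod p // f ≠ 0 ∧ numRoots p f = 2} := by
    refine Nat.card_congr (Equiv.subtypeEquivRight fun f => ⟨fun h => ⟨?_, h⟩, And.right⟩)
    rintro rfl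
    rw [numRoots_zero] at h
    exact hp.ne_one (by omega)
  have hdisc := card_one_root_disc_add (p := p)
  rw [card_one_root_disc_eq_zero] at hdisc ⊢
  rw [h2]
  have e0 := choose_add_sum_choose_mul_card (p := p) 0 (by norm_num)
  have e1 := choose_add_sum_choose_mul_card (p := p) 1 (by norm_num)
  have e2 := choose_add_sum_choose_mul_card (p := p) 2 (by norm_num)
  have e3 := choose_add_sum_choose_mul_card (p := p) 3 (by norm_num)
  have c2 := Nat.descFactorial_eq_factorial_mul_choose (p + 1) 2
  have c3 := Nat.descFactorial_eq_factorial_mul_choose (p + 1) 3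
  obtain ⟨m, rfl⟩ : ∃ m, p = m + 1 := ⟨p - 1, by have := hp.pos; omega⟩
  simp only [Finset.sum_range_succ, Finset.sum_range_zero, Nat.choose_zero_right,
    Nat.choose_one_right, Nat.choose_self, Nat.reduceSub, Nat.choose_zero_succ, pow_one,
    show Nat.choose 1 2 = 0 from rfl, show Nat.choose 1 3 = 0 from rfl,
    show Nat.choose 2 3 = 0 from rfl, show Nat.choose 3 2 = 3 from rfl] at e0 e1 e2 e3
  simp only [Nat.descFactorial_succ, Nat.descFactorial_zero, Nat.factorial, mul_one,
    Nat.sub_zero, show m + 1 + 1 - 2 = m by omega, Nat.add_sub_cancel] at c2 c3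
  simp only [Nat.add_sub_cancel] at hdisc ⊢
  generalize Nat.choose (m + 1 + 1) 2 = C2 at *
  generalize Nat.choose (m + 1 + 1) 3 = C3 at *
  generalize Nat.card {f // f ≠ 0 ∧ numRoots (m + 1) f = 0} = N0 at *
  generalize Nat.card {f // f ≠ 0 ∧ numRoots (m + 1) f = 1} = N1 at *
  generalize Nat.card {f // f ≠ 0 ∧ numRoots (m + 1) f = 2} = N2 at *
  generalize Nat.card {f // f ≠ 0 ∧ numRoots (m + 1) f = 3} = N3 at *
  generalize Nat.card {f // numRoots (m + 1) f = 1 ∧ discA f ≠ 0} = M at *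
  zify at *
  have r3 : (6 * N3 : ℤ) = m ^ 2 * (m + 1) * (m + 1 + 1) := by
    linear_combination 6 * e3 - m * c3
  have r2 : (N2 : ℤ) = m * (m + 1) * (m + 1 + 1) := by
    have : (2 * N2 : ℤ) = 2 * (m * (m + 1) * (m + 1 + 1)) := by
      linear_combination 2 * e2 - r3 - ((m + 1) ^ 2 - 1) * c2
    linarith
  have r1 : (2 * N1 : ℤ) = 2 * (m + 2) * ((m + 1) ^ 3 - 1) - 4 * N2 - 6 * N3 := by
    linear_combination 2 * e1
  refine ⟨r3, ?_, ?_, r2, trivial⟩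
  · linear_combination 2 * hdisc + r1 - 4 * r2 - r3
  · linarith
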